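/- arXiv:2307.03532 — 5 statements merged into one kernel-verified Lean document; each statement's English description precedes it below -/
import Mathlib

section
/- Let X be a connected topological space and f : X → ℝ a function. Then f is pseudo-continuous if and only if there exist a continuous function u : X → ℝ and a strictly increasing function h : u(X) → ℝ such that f = h ∘ u. -/
/-- `f` is upper pseudo-continuous: whenever `f x < f y`, there is a neighbourhood of `x`
on which `f` stays below `f y`. -/
def UpperPseudoContinuous {X : Type*} [TopologicalSpace X] (f : X → ℝ) : Prop :=
  ∀ x y : X, f x < f y → ∃ V ∈ nhds x, ∀ x' ∈ V, f x' < f y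

/-- `f` is lower pseudo-continuous: `-f` is upper pseudo-continuous. -/
def LowerPseudoContinuous {X : Type*} [TopologicalSpace X] (f : X → ℝ) : Prop :=
  UpperPseudoContinuous (fun x => -f x)

/-- `f` is pseudo-continuous: both upper and lower pseudo-continuous. -/
def PseudoContinuous {X : Type*} [TopologicalSpace X] (f : X → ℝ) : Prop :=
  UpperPseudoContinuous f ∧ LowerPseudoContinuous f

/-- A densely ordered linear order with a countable order-dense subset admits a strictly
increasing real function that is continuous for the order topology. -/
theorem exists_strictMono_continuous_of_countable_orderDense {α : Type*} [LinearOrder α]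
    [DenselyOrdered α] [TopologicalSpace α] [OrderTopology α] {s : Set α} (hs : s.Countable)
    (hd : ∀ a b : α, a < b → ∃ d ∈ s, a < d ∧ d < b) :
    ∃ g : α → ℝ, StrictMono g ∧ Continuous g := by
  rcases subsingleton_or_nontrivial α with hα | hα
  · exact ⟨fun _ => 0, Subsingleton.strictMono _, continuous_const⟩
  let D : Set α := {d | d ∈ s ∧ (∃ a, a < d) ∧ ∃ b, d < b}
  have hD : ∀ a b : α, a < b → ∃ d : D, a < d ∧ d < b := by
    intro a b hab
    obtain ⟨d, hds, had, hdb⟩ := hd a b hab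
    exact ⟨⟨d, hds, ⟨a, had⟩, ⟨b, hdb⟩⟩, had, hdb⟩
  have : Countable D := (hs.mono fun d hd => hd.1).to_subtype
  have : Nonempty D := by
    obtain ⟨a, b, hab⟩ := exists_pair_lt α
    exact ⟨(hD a b hab).choose⟩
  have : DenselyOrdered D := ⟨fun a b hab => hD a b hab⟩
  have : NoMinOrder D := ⟨fun d => by
    obtain ⟨a, ha⟩ := d.2.2.1
    obtain ⟨e, -, he⟩ := hD a d ha
    exact ⟨e, he⟩⟩
  have : NoMaxOrder D := ⟨fun d => by
    obtain ⟨b, hb⟩ := d.2.2.2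
    obtain ⟨e, he, -⟩ := hD d b hb
    exact ⟨e, he⟩⟩
  have : Nonempty (Set.Ioo (0 : ℚ) 1) := ⟨⟨1 / 2, by norm_num, by norm_num⟩⟩
  obtain ⟨e⟩ := Order.iso_of_countable_dense D (Set.Ioo (0 : ℚ) 1)
  let φ : D → ℝ := fun d => ((e d : ℚ) : ℝ)
  have hφ : StrictMono φ := fun a b hab => Rat.cast_lt.2 (e.strictMono hab)
  have hφ0 : ∀ d, 0 < φ d := fun d => Rat.cast_pos.2 (e d).2.1
  have hφ1 : ∀ d, φ d < 1 := fun d => (Rat.cast_lt.2 (e d).2.2).trans_eq Rat.cast_one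
  have hφ_dense : ∀ b c : ℝ, 0 ≤ b → b < c → c ≤ 1 → ∃ d, b < φ d ∧ φ d < c := by
    intro b c hb hbc hc
    obtain ⟨r, hbr, hrc⟩ := exists_rat_btwn hbc
    have hr0 : 0 < r := by exact_mod_cast hb.trans_lt hbr
    have hr1 : r < 1 := by exact_mod_cast hrc.trans_le hc
    refine ⟨e.symm ⟨r, hr0, hr1⟩, ?_, ?_⟩ <;> simpa [φ]
  classical
  let g : α → ℝ := fun a => ⨆ d : D, if (d : α) < a then φ d else 0
  have hbdd : ∀ a, BddAbove (Set.range fun d : D => if (d : α) < a then φ d else 0) := by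
    rintro a
    refine ⟨1, ?_⟩
    rintro _ ⟨d, rfl⟩
    dsimp only
    split_ifs
    exacts [(hφ1 d).le, zero_le_one]
  have hg0 : ∀ a, 0 ≤ g a := fun a => Real.iSup_nonneg fun d => by
    split_ifs
    exacts [(hφ0 d).le, le_rfl]
  have hg1 : ∀ a, g a ≤ 1 := fun a => ciSup_le fun d => by
    split_ifs
    exacts [(hφ1 d).le, zero_le_one]
  have hle : ∀ (d : D) (a : α), (d : α) < a → φ d ≤ g a := fun d a h => by
    simpa [h] using le_ciSup (hbdd a) d
  have hge : ∀ (d : D) (a : α), a ≤ d → g a ≤ φ d := fun d a h => ciSup_le fun d' => by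
    split_ifs with h'
    exacts [(hφ (show d' < d from h'.trans_le h)).le, (hφ0 d).le]
  refine ⟨g, fun a b hab => ?_, continuous_iff_continuousAt.2 fun a => tendsto_order.2 ⟨?_, ?_⟩⟩
  · obtain ⟨d, had, hdb⟩ := hD a b hab
    obtain ⟨d', hdd', hd'b⟩ := hD d b hdb
    exact (hge d a had.le).trans_lt ((hφ hdd').trans_le (hle d' b hd'b))
  · intro c hc
    rcases lt_or_ge c 0 with hc0 | hc0
    · exact Filter.Eventually.of_forall fun b => hc0.trans_le (hg0 b)
    obtain ⟨d, hcd⟩ := exists_lt_of_lt_ciSup hc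
    split_ifs at hcd with hda
    · filter_upwards [lt_mem_nhds hda] with b hb using hcd.trans_le (hle d b hb)
    · exact absurd hcd hc0.not_gt
  · intro c hc
    rcases lt_or_ge 1 c with hc1 | hc1
    · exact Filter.Eventually.of_forall fun b => (hg1 b).trans_lt hc1
    obtain ⟨d, had, hdc⟩ := hφ_dense _ _ (hg0 a) hc hc1
    obtain ⟨d', had', hd'd⟩ := hφ_dense _ _ (hg0 a) had (hφ1 d).le
    have h : a < d :=
      (not_lt.1 fun h => had'.not_ge (hle d' a h)).trans_lt (hφ.lt_iff_lt.1 hd'd)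
    filter_upwards [gt_mem_nhds h] with b hb using (hge d b hb.le).trans_lt hdc

theorem UpperPseudoContinuous.isOpen_setOf_lt {X : Type*} [TopologicalSpace X] {f : X → ℝ}
    (hf : UpperPseudoContinuous f) (y : X) : IsOpen {x | f x < f y} :=
  isOpen_iff_mem_nhds.2 fun x hx => by
    obtain ⟨V, hV, h⟩ := hf x y hx
    exact Filter.mem_of_superset hV h

theorem LowerPseudoContinuous.isOpen_setOf_gt {X : Type*} [TopologicalSpace X] {f : X → ℝ}
    (hf : LowerPseudoContinuous f) (y : X) : IsOpen {x | f y < f x} := by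
  simpa only [neg_lt_neg_iff] using UpperPseudoContinuous.isOpen_setOf_lt hf y

/-- A pseudo-continuous function on a connected space has a densely ordered range. -/
theorem PseudoContinuous.denselyOrdered_range {X : Type*} [TopologicalSpace X]
    [PreconnectedSpace X] {f : X → ℝ} (hf : PseudoContinuous f) :
    DenselyOrdered (Set.range f) := by
  refine ⟨?_⟩
  rintro ⟨_, x, rfl⟩ ⟨_, y, rfl⟩ hxy
  replace hxy : f x < f y := hxy
  by_contra! h
  have hgap : ∀ z, f x < f z → f y ≤ f z := fun z hz => h ⟨f z, z, rfl⟩ hz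
  obtain ⟨z, hzy, hxz⟩ := nonempty_inter (hf.1.isOpen_setOf_lt y) (hf.2.isOpen_setOf_gt x)
    (Set.eq_univ_of_forall fun z => (lt_or_ge (f z) (f y)).imp_right hxy.trans_le)
    ⟨x, hxy⟩ ⟨y, hxy⟩
  exact (hgap z hxz).not_gt hzy

/-- **(Scalzo)** On a connected topological space, `f` is pseudo-continuous iff
it factors as a strictly increasing function (on the range of `u`) composed with
a continuous function `u`. -/
theorem pseudoContinuous_iff_exists_strictMonoOn_comp_continuous
    {X : Type*} [TopologicalSpace X] [ConnectedSpace X] (f : X → ℝ) :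
    PseudoContinuous f ↔
      ∃ (u : X → ℝ) (h : ℝ → ℝ), Continuous u ∧ StrictMonoOn h (Set.range u) ∧
        f = h ∘ u := by
  constructor
  · intro hf
    have hdense := hf.denselyOrdered_range
    obtain ⟨s, hs, hsd⟩ := TopologicalSpace.exists_countable_dense (Set.range f)
    have hd : ∀ a b : Set.range f, a < b → ∃ d ∈ s, a < d ∧ d < b := fun a b hab => by
      obtain ⟨d, hd, hds⟩ := hsd.inter_open_nonempty (Set.Ioo a b) isOpen_Ioo
        (exists_between hab)
      exact ⟨d, hds, hd⟩
    let τ : TopologicalSpace (Set.range f) := Preorder.topology _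
    have hτ : @OrderTopology (Set.range f) τ _ := @OrderTopology.mk _ τ _ rfl
    obtain ⟨g, hg, hgc⟩ :=
      @exists_strictMono_continuous_of_countable_orderDense _ _ _ τ hτ s hs hd
    have hfc : @Continuous X (Set.range f) _ τ (Set.rangeFactorization f) := by
      refine continuous_generateFrom_iff.2 ?_
      rintro _ ⟨⟨_, y, rfl⟩, rfl | rfl⟩
      exacts [hf.2.isOpen_setOf_gt y, hf.1.isOpen_setOf_lt y]
    have hu : ∀ x y, g (Set.rangeFactorization f x) < g (Set.rangeFactorization f y) ↔
        f x < f y := fun x y => hg.lt_iff_lt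
    have hinv : ∀ x, f (Function.invFun (g ∘ Set.rangeFactorization f)
        (g (Set.rangeFactorization f x))) = f x := fun x =>
      congrArg Subtype.val
        (hg.injective (Function.invFun_eq (f := g ∘ Set.rangeFactorization f) ⟨x, rfl⟩))
    refine ⟨g ∘ Set.rangeFactorization f,
      f ∘ Function.invFun (g ∘ Set.rangeFactorization f),
      @Continuous.comp _ _ _ _ τ _ _ _ hgc hfc, ?_, funext fun x => (hinv x).symm⟩
    rintro _ ⟨x, rfl⟩ _ ⟨y, rfl⟩ hxy
    simpa only [Function.comp_apply, hinv] using (hu x y).1 hxy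
  · rintro ⟨u, h, hu, hh, rfl⟩
    have hlt : ∀ x y, h (u x) < h (u y) ↔ u x < u y := fun x y =>
      hh.lt_iff_lt ⟨x, rfl⟩ ⟨y, rfl⟩
    refine ⟨fun x y hxy => ⟨{z | u z < u y}, ?_, fun z hz => (hlt z y).2 hz⟩,
      fun x y hxy => ⟨{z | u y < u z}, ?_, fun z hz => neg_lt_neg ((hlt y z).2 hz)⟩⟩
    · exact (isOpen_lt hu continuous_const).mem_nhds ((hlt x y).1 hxy)
    · exact (isOpen_lt continuous_const hu).mem_nhds ((hlt y x).1 (neg_lt_neg_iff.1 hxy))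
end

section
/- Let X be a convex nonempty subset of ℝ^n and f : ℝ^n → ℝ a continuous quasi-convex function. If x̂ ∈ X satisfies ⟨y*, y − x̂⟩ ≥ 0 for every y ∈ X and every y* ∈ N^s(y), then x̂ minimizes f over X, i.e., f(x̂) ≤ f(y) for all y ∈ X. -/
open RealInnerProductSpace

/-- The normal cone `N^s(x)` to the strict lower level set `S^<_f(x) = {y | f y < f x}`:
when the strict level set is empty it is all of `ℝⁿ`, and the defining condition below is
then vacuously satisfied, so both cases are captured by this single predicate. -/
def strictNormalCone {n : ℕ} (f : EuclideanSpace ℝ (Fin n) → ℝ) (x : EuclideanSpace ℝ (Fin n)) :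
    Set (EuclideanSpace ℝ (Fin n)) :=
  {v | ∀ y : EuclideanSpace ℝ (Fin n), f y < f x → ⟪v, y - x⟫ ≤ 0}

/-- The strict lower level set of a continuous quasi-convex function at `x` lies in an open
half-space bounded by a hyperplane through `x`. -/
theorem exists_inner_sub_neg_of_lt {E : Type*} [NormedAddCommGroup E] [InnerProductSpace ℝ E]
    [CompleteSpace E] {f : E → ℝ} (hf : Continuous f)
    (hqc : ∀ x y : E, ∀ t ∈ Set.Icc (0:ℝ) 1, f (t • x + (1 - t) • y) ≤ max (f x) (f y)) (x : E) :
    ∃ v : E, ∀ y, f y < f x → ⟪v, y - x⟫ < 0 := by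
  have hconv : Convex ℝ {y | f y < f x} := by
    intro a ha b hb s r hs hr hsr
    obtain rfl : r = 1 - s := by linarith
    exact (hqc a b s ⟨hs, by linarith⟩).trans_lt (max_lt ha hb)
  obtain ⟨g, hg⟩ := geometric_hahn_banach_open_point hconv (isOpen_lt hf continuous_const)
    (lt_irrefl (f x))
  refine ⟨(InnerProductSpace.toDual ℝ E).symm g, fun y hy => ?_⟩
  rw [InnerProductSpace.toDual_symm_apply, map_sub]
  exact sub_neg.2 (hg y hy)

/-- If `X ⊆ ℝⁿ` is convex and nonempty, `f` is continuous and quasi-convex, and `xhat ∈ X`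
satisfies `⟪y*, y - xhat⟫ ≥ 0` for all `y ∈ X` and `y* ∈ N^s(y)`, then `xhat` minimizes `f`
over `X`. -/
theorem minimizer_of_minty_strictNormalCone {n : ℕ}
    (X : Set (EuclideanSpace ℝ (Fin n))) (hXconv : Convex ℝ X) (hXne : X.Nonempty)
    (f : EuclideanSpace ℝ (Fin n) → ℝ) (hf : Continuous f)
    (hqc : ∀ x y : EuclideanSpace ℝ (Fin n), ∀ t ∈ Set.Icc (0:ℝ) 1,
      f (t • x + (1 - t) • y) ≤ max (f x) (f y))
    (xhat : EuclideanSpace ℝ (Fin n)) (hxhat : xhat ∈ X)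
    (hminty : ∀ y ∈ X, ∀ ystar ∈ strictNormalCone f y, 0 ≤ ⟪ystar, y - xhat⟫) :
    ∀ y ∈ X, f xhat ≤ f y := by
  intro y hy
  by_contra! hlt
  have hcont : Continuous fun t : ℝ => f (t • y + (1 - t) • xhat) := by fun_prop
  have hnear : ∀ᶠ t in nhdsWithin (0 : ℝ) (Set.Ioi 0), f y < f (t • y + (1 - t) • xhat) :=
    (hcont.continuousAt.eventually_const_lt (by simpa using hlt)).filter_mono nhdsWithin_le_nhds
  obtain ⟨t, hft, ht0, ht1⟩ :=
    (hnear.and (Ioo_mem_nhdsGT (zero_lt_one (α := ℝ)))).exists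
  set z := t • y + (1 - t) • xhat with hz
  have hzX : z ∈ X := hXconv hy hxhat ht0.le (sub_nonneg.2 ht1.le) (by ring)
  obtain ⟨v, hv⟩ := exists_inner_sub_neg_of_lt hf hqc z
  have hyz : ⟪v, y - z⟫ < 0 := hv y hft
  have hzx : 0 ≤ ⟪v, z - xhat⟫ := hminty z hzX v fun w hw => (hv w hw).le
  rw [show y - z = (1 - t) • (y - xhat) by rw [hz]; module, real_inner_smul_right] at hyz
  rw [show z - xhat = t • (y - xhat) by rw [hz]; module, real_inner_smul_right] at hzx
  exact (neg_of_mul_neg_right hyz (sub_pos.2 ht1).le).not_ge (nonneg_of_mul_nonneg_right hzx ht0)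
end

section
/- Let a < b be real numbers and T a set-valued map from [a,b] to ℝ^m with nonempty values. If the graph of T, i.e., {(u,v) ∈ ℝ × ℝ^m : u ∈ [a,b], v ∈ T(u)}, is a convex set and T(a) ∪ T(b) is bounded, then T is lower semicontinuous on [a,b]: for every x ∈ [a,b], every sequence (x_n) in [a,b] converging to x, and every y ∈ T(x), there exists a sequence (y_n) converging to y with y_n ∈ T(x_n) for all n. -/
open Filter Topology

/-- If the graph of `T` over `[a, b]` is convex, then it contains the segment joining a point `y` over
`x` to a point `z` over `c`. The coefficient `0 / 0 = 0` covers the degenerate case `c = x`. -/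
lemma add_smul_sub_mem_of_convex_graph {E : Type*} [AddCommGroup E] [Module ℝ E] {s : Set ℝ}
    {T : ℝ → Set E} (hgraph : Convex ℝ {p : ℝ × E | p.1 ∈ s ∧ p.2 ∈ T p.1})
    {x c u : ℝ} {y z : E} (hx : x ∈ s) (hc : c ∈ s) (hy : y ∈ T x) (hz : z ∈ T c)
    (hu : u ∈ segment ℝ x c) : y + ((u - x) / (c - x)) • (z - y) ∈ T u := by
  rw [segment_eq_image'] at hu
  obtain ⟨t, ht, rfl⟩ := hu
  rcases eq_or_ne c x with rfl | hcx
  · simpa using hy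
  · have hmem := hgraph.add_smul_sub_mem (x := (x, y)) (y := (c, z)) ⟨hx, hy⟩ ⟨hc, hz⟩ ht
    have hne : c - x ≠ 0 := sub_ne_zero.mpr hcx
    have hcoef : (x + t • (c - x) - x) / (c - x) = t := by
      rw [smul_eq_mul]
      field_simp
      ring
    rw [hcoef]
    exact hmem.2

/-- A set-valued map from `[a,b] ⊆ ℝ` to `ℝᵐ` with nonempty values whose graph is convex
and whose values at the endpoints are bounded is (sequentially) lower semicontinuous. -/
theorem lowerSemicontinuous_of_convex_graph {m : ℕ} (a b : ℝ) (hab : a < b)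
    (T : ℝ → Set (EuclideanSpace ℝ (Fin m)))
    (hne : ∀ u ∈ Set.Icc a b, (T u).Nonempty)
    (hgraph : Convex ℝ {p : ℝ × EuclideanSpace ℝ (Fin m) | p.1 ∈ Set.Icc a b ∧ p.2 ∈ T p.1})
    (hbdd : Bornology.IsBounded (T a ∪ T b)) :
    ∀ x ∈ Set.Icc a b, ∀ xs : ℕ → ℝ, (∀ k, xs k ∈ Set.Icc a b) →
      Tendsto xs atTop (𝓝 x) → ∀ y ∈ T x,
        ∃ ys : ℕ → EuclideanSpace ℝ (Fin m),
          Tendsto ys atTop (𝓝 y) ∧ ∀ k, ys k ∈ T (xs k) := by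
  intro x hx xs hxs hlim y hy
  obtain ⟨p, hp⟩ := hne a (Set.left_mem_Icc.mpr hab.le)
  obtain ⟨q, hq⟩ := hne b (Set.right_mem_Icc.mpr hab.le)
  let f : ℝ → EuclideanSpace ℝ (Fin m) := fun u ↦
    y + (min (u - x) 0 / (a - x)) • (p - y) + (max (u - x) 0 / (b - x)) • (q - y)
  have hf : Continuous f := by fun_prop
  have hfx : f x = y := by simp [f]
  refine ⟨fun k ↦ f (xs k), ?_, fun k ↦ ?_⟩
  · simpa only [hfx, Function.comp_def] using (hf.tendsto x).comp hlim
  · rcases le_total (xs k) x with h | h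
    · have hseg : xs k ∈ segment ℝ x a := by
        rw [segment_symm, segment_eq_Icc hx.1]
        exact ⟨(hxs k).1, h⟩
      simpa [f, h] using add_smul_sub_mem_of_convex_graph hgraph hx
        (Set.left_mem_Icc.mpr hab.le) hy hp hseg
    · have hseg : xs k ∈ segment ℝ x b := by
        rw [segment_eq_Icc hx.2]
        exact ⟨h, (hxs k).2⟩
      simpa [f, h] using add_smul_sub_mem_of_convex_graph hgraph hx
        (Set.right_mem_Icc.mpr hab.le) hy hq hseg
end

section
/- Let X be a convex, compact, nonempty subset of ℝ², and let θ₁, θ₂ : ℝ² → ℝ be continuous functions such that for every fixed x² ∈ ℝ the map x¹ ↦ θ₁(x¹, x²) is quasi-convex and for every fixed x¹ ∈ ℝ the map x² ↦ θ₂(x¹, x²) is quasi-convex. Then there exists (x̂¹, x̂²) ∈ X such that θ₁(x̂¹, x̂²) ≤ θ₁(y¹, x̂²) for every y¹ ∈ ℝ with (y¹, x̂²) ∈ X, and θ₂(x̂¹, x̂²) ≤ θ₂(x̂¹, y²) for every y² ∈ ℝ with (x̂¹, y²) ∈ X. -/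
open Filter Topology

section Fibers

variable {E : Type*} [NormedAddCommGroup E] [NormedSpace ℝ E]

/-- The points of `X` minimizing `θ` on their fiber of `L : E → ℝ` in `X`. -/
def fiberMinimizers (X : Set E) (L : E →L[ℝ] ℝ) (θ : E → ℝ) : Set E :=
  {x | x ∈ X ∧ ∀ y ∈ X, L y = L x → θ x ≤ θ y}

lemma Convex.eventually_exists_fiber_of_ne {X : Set E} (hX : Convex ℝ X) (L : E →L[ℝ] ℝ)
    {y z : E} (hy : y ∈ X) (hz : z ∈ X) (hne : L z ≠ L y) {V : Set E} (hV : V ∈ 𝓝 y) :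
    ∀ᶠ s in 𝓝 (L y), 0 ≤ (s - L y) / (L z - L y) → ∃ q ∈ X, L q = s ∧ q ∈ V := by
  have hd : L z - L y ≠ 0 := sub_ne_zero.2 hne
  have hτ : Tendsto (fun s : ℝ => (s - L y) / (L z - L y)) (𝓝 (L y)) (𝓝 0) := by
    have : Continuous fun s : ℝ => (s - L y) / (L z - L y) := by fun_prop
    simpa using this.tendsto (L y)
  have hγ : Tendsto (fun s : ℝ => y + ((s - L y) / (L z - L y)) • (z - y)) (𝓝 (L y)) (𝓝 y) := by
    simpa using tendsto_const_nhds.add (hτ.smul_const (z - y))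
  filter_upwards [hγ hV, hτ (Iio_mem_nhds one_pos)] with s hsV hs1 hs0
  refine ⟨_, hX.add_smul_sub_mem hy hz ⟨hs0, le_of_lt hs1⟩, ?_, hsV⟩
  simp only [map_add, map_smul, map_sub, smul_eq_mul]
  field_simp
  ring

/-- A linear functional is relatively open on a convex set. -/
lemma Convex.eventually_exists_fiber {X : Set E} (hX : Convex ℝ X) (L : E →L[ℝ] ℝ)
    {y : E} (hy : y ∈ X) {V : Set E} (hV : V ∈ 𝓝 y) :
    ∀ᶠ s in 𝓝 (L y), s ∈ L '' X → ∃ q ∈ X, L q = s ∧ q ∈ V := by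
  have hup : ∀ᶠ s in 𝓝 (L y), s ∈ L '' X → L y < s → ∃ q ∈ X, L q = s ∧ q ∈ V := by
    by_cases h : ∃ z ∈ X, L y < L z
    · obtain ⟨z, hz, hlt⟩ := h
      filter_upwards [hX.eventually_exists_fiber_of_ne L hy hz hlt.ne' hV] with s hs _ hys
      exact hs (div_nonneg (sub_nonneg.2 hys.le) (sub_nonneg.2 hlt.le))
    · refine Eventually.of_forall ?_
      rintro _ ⟨w, hw, rfl⟩ hlt
      exact absurd ⟨w, hw, hlt⟩ h
  have hdown : ∀ᶠ s in 𝓝 (L y), s ∈ L '' X → s < L y → ∃ q ∈ X, L q = s ∧ q ∈ V := by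
    by_cases h : ∃ z ∈ X, L z < L y
    · obtain ⟨z, hz, hlt⟩ := h
      filter_upwards [hX.eventually_exists_fiber_of_ne L hy hz hlt.ne hV] with s hs _ hys
      exact hs (div_nonneg_of_nonpos (sub_nonpos.2 hys.le) (sub_nonpos.2 hlt.le))
    · refine Eventually.of_forall ?_
      rintro _ ⟨w, hw, rfl⟩ hlt
      exact absurd ⟨w, hw, hlt⟩ h
  filter_upwards [hup, hdown] with s h₁ h₂ hs
  rcases lt_trichotomy s (L y) with h | h | h
  · exact h₂ hs h
  · exact ⟨y, hy, h.symm, mem_of_mem_nhds hV⟩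
  · exact h₁ hs h

lemma isCompact_fiberMinimizers {X : Set E} (hX : Convex ℝ X) (hXc : IsCompact X)
    (L : E →L[ℝ] ℝ) {θ : E → ℝ} (hθ : Continuous θ) : IsCompact (fiberMinimizers X L θ) := by
  refine hXc.of_isClosed_subset (isClosed_of_closure_subset fun x hx => ?_) fun x hx => hx.1
  have hxX : x ∈ X := closure_minimal (fun z hz => hz.1) hXc.isClosed hx
  refine ⟨hxX, fun y hy hyx => ?_⟩
  by_contra! hlt
  obtain ⟨c, hyc, hcx⟩ := exists_between hlt
  have hV : {q | θ q < c} ∈ 𝓝 y := (isOpen_lt hθ continuous_const).mem_nhds hyc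
  have hU : ∀ᶠ z in 𝓝 x, c < θ z := (isOpen_lt continuous_const hθ).mem_nhds hcx
  have hW := hX.eventually_exists_fiber L hy hV
  rw [hyx] at hW
  obtain ⟨z, hz, hcz, hzq⟩ := ((mem_closure_iff_frequently.1 hx).and_eventually
    (hU.and (L.continuous.continuousAt.eventually hW))).exists
  obtain ⟨q, hq, hqz, hqc⟩ := hzq ⟨z, hz.1, rfl⟩
  exact absurd (hz.2 q hq hqz) (not_le.2 (lt_trans hqc hcz))

lemma exists_mem_fiberMinimizers {X : Set E} (hXc : IsCompact X) (L : E →L[ℝ] ℝ) {θ : E → ℝ}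
    (hθ : Continuous θ) {x : E} (hx : x ∈ X) : ∃ z ∈ fiberMinimizers X L θ, L z = L x := by
  obtain ⟨z, hz, hmin⟩ := (hXc.inter_right
    (isClosed_eq L.continuous (continuous_const (y := L x)))).exists_isMinOn ⟨x, hx, rfl⟩
    hθ.continuousOn
  exact ⟨z, ⟨hz.1, fun y hy hyz => hmin ⟨hy, hyz.trans hz.2⟩⟩, hz.2⟩

lemma image_fiberMinimizers {X : Set E} (hXc : IsCompact X) (L : E →L[ℝ] ℝ) {θ : E → ℝ}
    (hθ : Continuous θ) : L '' fiberMinimizers X L θ = L '' X := by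
  refine (Set.image_mono fun x hx => hx.1).antisymm ?_
  rintro _ ⟨x, hx, rfl⟩
  exact exists_mem_fiberMinimizers hXc L hθ hx

lemma convex_fiberMinimizers_inter {X : Set E} (hX : Convex ℝ X) (L : E →L[ℝ] ℝ) {θ : E → ℝ}
    (hq : ∀ x y, L x = L y → ∀ t ∈ Set.Icc (0 : ℝ) 1,
      θ (t • x + (1 - t) • y) ≤ max (θ x) (θ y)) (s : ℝ) :
    Convex ℝ (fiberMinimizers X L θ ∩ L ⁻¹' {s}) := by
  rintro x ⟨⟨hx, hxm⟩, rfl⟩ y ⟨⟨hy, hym⟩, hyx⟩ a b ha hb hab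
  simp only [Set.mem_preimage, Set.mem_singleton_iff] at hyx
  obtain rfl : b = 1 - a := by linarith
  have hL : L (a • x + (1 - a) • y) = L x := by
    simp only [map_add, map_smul, smul_eq_mul, hyx]
    ring
  refine ⟨⟨hX hx hy ha hb hab, fun z hz hzx => ?_⟩, hL⟩
  rw [hL] at hzx
  exact (hq x y hyx.symm a ⟨ha, by linarith⟩).trans
    (max_le (hxm z hz hzx) (hym z hz (hzx.trans hyx.symm)))

end Fibers

/-- A compact set is preconnected if its image under a continuous map is preconnected and all
its fibers are. -/
lemma IsCompact.isPreconnected_of_fibers {α β : Type*} [TopologicalSpace α] [TopologicalSpace β]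
    [T2Space β] {G : Set α} (hG : IsCompact G) {f : α → β} (hf : Continuous f)
    (himg : IsPreconnected (f '' G)) (hfib : ∀ b, IsPreconnected (G ∩ f ⁻¹' {b})) :
    IsPreconnected G := by
  rw [isPreconnected_closed_iff]
  rintro A B hA hB hAB ⟨a, haG, haA⟩ ⟨b, hbG, hbB⟩
  obtain ⟨_, -, ⟨a', ⟨ha'G, ha'A⟩, rfl⟩, ⟨b', ⟨hb'G, hb'B⟩, hab⟩⟩ :=
    isPreconnected_closed_iff.1 himg (f '' (G ∩ A)) (f '' (G ∩ B))
      ((hG.inter_right hA).image hf).isClosed ((hG.inter_right hB).image hf).isClosed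
      (by
        rintro _ ⟨x, hx, rfl⟩
        exact (hAB hx).imp (fun h => ⟨x, ⟨hx, h⟩, rfl⟩) fun h => ⟨x, ⟨hx, h⟩, rfl⟩)
      ⟨f a, ⟨a, haG, rfl⟩, a, ⟨haG, haA⟩, rfl⟩ ⟨f b, ⟨b, hbG, rfl⟩, b, ⟨hbG, hbB⟩, rfl⟩
  obtain ⟨x, ⟨hxG, -⟩, hx⟩ := isPreconnected_closed_iff.1 (hfib (f a')) A B hA hB
    (Set.inter_subset_left.trans hAB) ⟨a', ⟨ha'G, rfl⟩, ha'A⟩ ⟨b', ⟨hb'G, hab⟩, hb'B⟩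
  exact ⟨x, hxG, hx⟩

/-- Two compact plane sets meet if the first is preconnected, each of its points shares its second
coordinate with a point of the second set, the second set has convex horizontal sections, and
the first coordinates of the second set range within those of the first. -/
lemma IsPreconnected.inter_nonempty_of_convex_sections {G H : Set (ℝ × ℝ)}
    (hGc : IsCompact G) (hHc : IsCompact H) (hG : IsPreconnected G) (hne : G.Nonempty)
    (hGH : ∀ x ∈ G, ∃ y ∈ H, y.2 = x.2) (hHG : Prod.fst '' H ⊆ Prod.fst '' G)
    (hH : ∀ s, Convex ℝ (H ∩ Prod.snd ⁻¹' {s})) : (G ∩ H).Nonempty := by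
  have hclosed : ∀ C : Set ((ℝ × ℝ) × (ℝ × ℝ)), IsClosed C →
      IsClosed (Prod.fst '' ((G ×ˢ H) ∩ C)) := fun C hC =>
    (((hGc.prod hHc).inter_right hC).image continuous_fst).isClosed
  obtain ⟨l, hl, hlmin⟩ := hGc.exists_isMinOn hne continuous_fst.continuousOn
  obtain ⟨u, hu, humax⟩ := hGc.exists_isMaxOn hne continuous_fst.continuousOn
  have hlH : ∀ y ∈ H, l.1 ≤ y.1 := fun y hy => by
    obtain ⟨z, hz, hzy⟩ := hHG ⟨y, hy, rfl⟩
    exact hzy ▸ hlmin hz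
  have huH : ∀ y ∈ H, y.1 ≤ u.1 := fun y hy => by
    obtain ⟨z, hz, hzy⟩ := hHG ⟨y, hy, rfl⟩
    exact hzy ▸ humax hz
  obtain ⟨yl, hyl, hyl2⟩ := hGH l hl
  obtain ⟨yu, hyu, hyu2⟩ := hGH u hu
  have hsnd : IsClosed {p : (ℝ × ℝ) × (ℝ × ℝ) | p.2.2 = p.1.2} :=
    isClosed_eq (by fun_prop) (by fun_prop)
  have hle : IsClosed {p : (ℝ × ℝ) × (ℝ × ℝ) | p.1.1 ≤ p.2.1} :=
    isClosed_le (by fun_prop) (by fun_prop)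
  have hge : IsClosed {p : (ℝ × ℝ) × (ℝ × ℝ) | p.2.1 ≤ p.1.1} :=
    isClosed_le (by fun_prop) (by fun_prop)
  obtain ⟨_, hx, ⟨⟨x, y⟩, ⟨⟨-, hy⟩, hy2, hxy⟩, rfl⟩, ⟨⟨w, z⟩, ⟨⟨-, hz⟩, hz2, hzx⟩, hw⟩⟩ :=
    isPreconnected_closed_iff.1 hG _ _
      (hclosed _ (hsnd.inter hle))
      (hclosed _ (hsnd.inter hge))
      (by
        intro x hx
        obtain ⟨y, hy, hyx⟩ := hGH x hx
        exact (le_total x.1 y.1).imp (fun h => ⟨(x, y), ⟨⟨hx, hy⟩, hyx, h⟩, rfl⟩)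
          fun h => ⟨(x, y), ⟨⟨hx, hy⟩, hyx, h⟩, rfl⟩)
      ⟨l, hl, (l, yl), ⟨⟨hl, hyl⟩, hyl2, hlH yl hyl⟩, rfl⟩
      ⟨u, hu, (u, yu), ⟨⟨hu, hyu⟩, hyu2, huH yu hyu⟩, rfl⟩
  obtain rfl : x = w := hw.symm
  change y.2 = x.2 at hy2
  change z.2 = x.2 at hz2
  obtain ⟨a, b, ha, hb, hab, habx⟩ :=
    (Convex.ordConnected (convex_segment z.1 y.1 (𝕜 := ℝ))).out
      (left_mem_segment ℝ _ _) (right_mem_segment ℝ _ _) ⟨hzx, hxy⟩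
  have hmem := hH x.2 ⟨hz, hz2⟩ ⟨hy, hy2⟩ ha hb hab
  have heq : a • z + b • y = x := by
    refine Prod.ext habx ?_
    simp only [Prod.snd_add, Prod.smul_snd, hz2, hy2, ← add_smul, hab, one_smul]
  exact ⟨x, hx, heq ▸ hmem.1⟩


/-- **Two-player Rosen game in the plane.** If `X ⊆ ℝ²` is convex, compact and nonempty,
`θ₁, θ₂ : ℝ² → ℝ` are continuous, `θ₁` is quasi-convex in its first variable and `θ₂` is
quasi-convex in its second variable, then the Rosen game with shared constraint set `X`
admits a generalized Nash equilibrium. -/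
theorem rosen_gnep_two_players_plane
    (X : Set (ℝ × ℝ)) (hXconv : Convex ℝ X) (hXcomp : IsCompact X) (hXne : X.Nonempty)
    (θ₁ θ₂ : ℝ × ℝ → ℝ) (hc₁ : Continuous θ₁) (hc₂ : Continuous θ₂)
    (hq₁ : ∀ x2 : ℝ, ∀ s r : ℝ, ∀ t ∈ Set.Icc (0:ℝ) 1,
      θ₁ (t * s + (1 - t) * r, x2) ≤ max (θ₁ (s, x2)) (θ₁ (r, x2)))
    (hq₂ : ∀ x1 : ℝ, ∀ s r : ℝ, ∀ t ∈ Set.Icc (0:ℝ) 1,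
      θ₂ (x1, t * s + (1 - t) * r) ≤ max (θ₂ (x1, s)) (θ₂ (x1, r))) :
    ∃ xhat ∈ X,
      (∀ y1 : ℝ, (y1, xhat.2) ∈ X → θ₁ xhat ≤ θ₁ (y1, xhat.2)) ∧
      (∀ y2 : ℝ, (xhat.1, y2) ∈ X → θ₂ xhat ≤ θ₂ (xhat.1, y2)) := by
  have hG : IsCompact (fiberMinimizers X (.fst ℝ ℝ ℝ) θ₂) :=
    isCompact_fiberMinimizers hXconv hXcomp _ hc₂
  have hH : IsCompact (fiberMinimizers X (.snd ℝ ℝ ℝ) θ₁) :=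
    isCompact_fiberMinimizers hXconv hXcomp _ hc₁
  have himg := image_fiberMinimizers hXcomp (.fst ℝ ℝ ℝ) hc₂
  have hGconn : IsPreconnected (fiberMinimizers X (.fst ℝ ℝ ℝ) θ₂) := by
    refine hG.isPreconnected_of_fibers (ContinuousLinearMap.fst ℝ ℝ ℝ).continuous ?_ fun s =>
      (convex_fiberMinimizers_inter hXconv _ ?_ s).isPreconnected
    · rw [himg]
      exact hXconv.isPreconnected.image _ (ContinuousLinearMap.continuous _).continuousOn
    · rintro ⟨a, b⟩ ⟨c, d⟩ (rfl : a = c) t ht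
      have h := hq₂ a b d t ht
      rwa [show (a, t * b + (1 - t) * d) = t • (a, b) + (1 - t) • (a, d) from
        Prod.ext (by simp; ring) (by simp)] at h
  have hHconv : ∀ s, Convex ℝ
      (fiberMinimizers X (.snd ℝ ℝ ℝ) θ₁ ∩ ContinuousLinearMap.snd ℝ ℝ ℝ ⁻¹' {s}) := by
    refine convex_fiberMinimizers_inter hXconv _ ?_
    rintro ⟨a, b⟩ ⟨c, d⟩ (rfl : b = d) t ht
    have h := hq₁ b a c t ht
    rwa [show (t * a + (1 - t) * c, b) = t • (a, b) + (1 - t) • (c, b) from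
      Prod.ext (by simp) (by simp; ring)] at h
  obtain ⟨x, hx₂, hx₁⟩ := hGconn.inter_nonempty_of_convex_sections hG hH
    (Set.image_nonempty.1 (himg ▸ hXne.image _))
    (fun x hx => exists_mem_fiberMinimizers hXcomp (.snd ℝ ℝ ℝ) hc₁ hx.1)
    ((Set.image_mono fun x hx => hx.1).trans himg.ge) hHconv
  exact ⟨x, hx₁.1, fun y hy => hx₁.2 _ hy rfl, fun y hy => hx₂.2 _ hy rfl⟩
end

section
/- (Debreu–Glicksberg–Fan) For each ν ∈ N let K_ν be a compact, convex, nonempty subset of ℝ^{n_ν}, and let θ_ν : ℝ^n → ℝ be continuous and quasi-convex with respect to its player's variable. Then there exists x̂ ∈ ∏_{ν∈N} K_ν such that for every ν ∈ N and every y^ν ∈ K_ν, θ_ν(x̂) ≤ θ_ν(y^ν, x̂^{-ν}). -/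
/-- A finite set `S` is dominant for the rankings `r` if every point is weakly below all of `S`
in at least one ranking. -/
def IsDominant {V I L : Type*} [LinearOrder L] (r : I → V → L) (S : Finset V) : Prop :=
  ∀ y, ∃ i, ∀ x ∈ S, r i y ≤ r i x

theorem IsDominant.mono {V I L : Type*} [LinearOrder L] {r : I → V → L} {S D : Finset V}
    (h : IsDominant r S) (hD : D ⊆ S) : IsDominant r D := fun y =>
  (h y).imp fun _ hi x hx => hi x (hD hx)

open Classical in
/-- A dominant set one element short of the number of rankings, which is not made of slack points
only, extends to a dominant set by adding one point in exactly two ways. -/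
theorem IsDominant.card_extensions {V I L : Type*} [Fintype V] [Fintype I] [LinearOrder L]
    {r : I → V → L} (hr : ∀ i, Function.Injective (r i)) {s : I → V}
    (hmin : ∀ i v, v ≠ s i → r i (s i) < r i v)
    (hmax : ∀ i j v, i ≠ j → v ∉ Set.range s → r i v < r i (s j))
    {D : Finset V} (hD : IsDominant r D) (hcard : D.card + 1 = Fintype.card I)
    (hslack : ∃ x ∈ D, x ∉ Set.range s) :
    (Finset.univ.filter fun y => y ∉ D ∧ IsDominant r (insert y D)).card = 2 := by
  obtain ⟨x₀, hx₀D, hx₀⟩ := hslack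
  have hm : ∀ i, ∃ x ∈ D, ∀ y ∈ D, r i x ≤ r i y := fun i =>
    D.exists_min_image (r i) ⟨x₀, hx₀D⟩
  choose m hmD hmle using hm
  have hsurj : ∀ x ∈ D, ∃ i, m i = x := fun x hx => by
    obtain ⟨i, hi⟩ := hD x
    exact ⟨i, hr i (le_antisymm (hmle i x hx) (hi _ (hmD i)))⟩
  obtain ⟨a, -, b, -, hab, hmab⟩ :=
    Finset.exists_ne_map_eq_of_card_lt_of_maps_to (s := Finset.univ) (t := D) (f := m)
      (by rw [Finset.card_univ]; omega) (fun i _ => hmD i)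
  -- points beating `D` in all rankings but `j`
  let M : I → V → Prop := fun j y => ∀ i, i ≠ j → r i (m i) < r i y
  have hMle : ∀ j y, M j y → ∀ x ∈ D, r j y ≤ r j x := by
    intro j y hy
    obtain ⟨i, hi⟩ := hD y
    by_cases hij : i = j
    · subst hij; exact hi
    · exact absurd (hi _ (hmD i)) (not_le.2 (hy i hij))
  have hMne : ∀ j k, j ≠ k → m j = m k → ∃ y, M j y := by
    intro j k hjk hmjk
    refine ⟨s j, fun i hij => ?_⟩
    by_cases hi : m i ∈ Set.range s
    · obtain ⟨l, hl⟩ := hi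
      have hil : i = l := by
        by_contra hil
        have h1 := hmax i l x₀ hil hx₀
        rw [hl] at h1
        exact absurd (hmle i x₀ hx₀D) (not_le.2 h1)
      subst hil
      rw [← hl]
      refine hmin i _ fun hji => ?_
      have hsj : s j = m i := hji.trans hl
      have hjm : m j = s j := by
        by_contra hne
        exact absurd (hmle j _ (hsj ▸ hmD i)) (not_le.2 (hmin j _ hne))
      have h1 := hmax k j x₀ hjk.symm hx₀
      rw [← hjm, hmjk] at h1
      exact absurd (hmle k x₀ hx₀D) (not_le.2 h1)
    · exact hmax i j _ hij hi
  have key : ∀ j k, j ≠ k → m j = m k → ∃ y, M j y ∧ (∀ z, M j z → r j z ≤ r j y) ∧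
      y ∉ D ∧ IsDominant r (insert y D) := by
    intro j k hjk hmjk
    obtain ⟨y₀, hy₀⟩ := hMne j k hjk hmjk
    obtain ⟨y, hy, hymax⟩ := (Finset.univ.filter (M j)).exists_max_image (r j)
      ⟨y₀, by simpa using hy₀⟩
    simp only [Finset.mem_filter, Finset.mem_univ, true_and] at hy hymax
    refine ⟨y, hy, hymax, fun hyD => ?_, fun z => ?_⟩
    · obtain ⟨i, hi⟩ := hsurj y hyD
      by_cases hij : i = j
      · subst hij
        have := hy k hjk.symm
        rw [← hmjk, hi] at this
        exact lt_irrefl _ this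
      · have := hy i hij
        rw [hi] at this
        exact lt_irrefl _ this
    · by_cases hz : M j z
      · refine ⟨j, fun x hx => ?_⟩
        rcases Finset.mem_insert.1 hx with rfl | hx
        · exact hymax z hz
        · exact hMle j z hz x hx
      · simp only [M, not_forall, not_lt] at hz
        obtain ⟨i, hij, hi⟩ := hz
        refine ⟨i, fun x hx => ?_⟩
        rcases Finset.mem_insert.1 hx with rfl | hx
        · exact hi.trans (hy i hij).le
        · exact hi.trans (hmle i x hx)
  obtain ⟨ya, hMa, hmaxa, hyaD, hdoma⟩ := key a b hab hmab
  obtain ⟨yb, hMb, hmaxb, hybD, hdomb⟩ := key b a hab.symm hmab.symm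
  have hne : ya ≠ yb := by
    rintro rfl
    exact absurd (hMle a _ hMa _ (hmD a)) (not_le.2 (hMb a hab))
  rw [Finset.card_eq_two]
  refine ⟨ya, yb, hne, ?_⟩
  ext y
  simp only [Finset.mem_filter, Finset.mem_univ, true_and, Finset.mem_insert,
    Finset.mem_singleton]
  constructor
  · rintro ⟨hyD, hdom⟩
    obtain ⟨j, hj⟩ := hdom y
    let J := Finset.univ.filter fun i => r i (m i) < r i y
    have hjJ : j ∉ J := by
      simp only [J, Finset.mem_filter, Finset.mem_univ, true_and, not_lt]
      exact hj _ (Finset.mem_insert_of_mem (hmD j))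
    have hDJ : D ⊆ J.image m := by
      intro x hx
      obtain ⟨i, hi⟩ := hdom x
      have hxi : m i = x :=
        hr i (le_antisymm (hmle i x hx) (hi _ (Finset.mem_insert_of_mem (hmD i))))
      refine Finset.mem_image.2 ⟨i, ?_, hxi⟩
      simp only [J, Finset.mem_filter, Finset.mem_univ, true_and, hxi]
      refine lt_of_le_of_ne (hi _ (Finset.mem_insert_self _ _)) fun h => hyD ?_
      rwa [← hr i h]
    have hJle : J.card ≤ D.card := by
      have := Finset.card_lt_univ_of_notMem hjJ
      omega
    have hJD : (J.image m).card = J.card :=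
      le_antisymm Finset.card_image_le (hJle.trans (Finset.card_le_card hDJ))
    have hinj := Finset.card_image_iff.1 hJD
    have hDJc := Finset.card_le_card hDJ
    have hJuniv : ∀ i, i ≠ j → i ∈ J := by
      have h : insert j J = Finset.univ := by
        rw [← Finset.card_eq_iff_eq_univ, Finset.card_insert_of_notMem hjJ]
        omega
      intro i hij
      have := Finset.mem_univ i
      rw [← h, Finset.mem_insert] at this
      exact this.resolve_left hij
    have hMy : M j y := fun i hij => by simpa [J] using hJuniv i hij
    have huniq : ∀ y', M j y' → (∀ z, M j z → r j z ≤ r j y') → y = y' := by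
      intro y' hy' hmax'
      refine hr j (le_antisymm (hmax' y hMy) ?_)
      obtain ⟨i, hi⟩ := hdom y'
      by_cases hij : i = j
      · subst hij; exact hi _ (Finset.mem_insert_self _ _)
      · exact absurd (hi _ (Finset.mem_insert_of_mem (hmD i))) (not_le.2 (hy' i hij))
    by_cases hja : j = a
    · subst hja; exact Or.inl (huniq _ hMa hmaxa)
    · by_cases hjb : j = b
      · subst hjb; exact Or.inr (huniq _ hMb hmaxb)
      · exact absurd (hinj (hJuniv a (Ne.symm hja)) (hJuniv b (Ne.symm hjb)) hmab) hab
  · rintro (rfl | rfl)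
    · exact ⟨hyaD, hdoma⟩
    · exact ⟨hybD, hdomb⟩

open Classical in
/-- The set of all slack points but one extends to a dominant set by adding one point in exactly
one way. -/
theorem card_extensions_slack {V I L : Type*} [Fintype V] [Fintype I] [LinearOrder L]
    {r : I → V → L} (hr : ∀ i, Function.Injective (r i)) {s : I → V}
    (hmin : ∀ i v, v ≠ s i → r i (s i) < r i v)
    (hmax : ∀ i j v, i ≠ j → v ∉ Set.range s → r i v < r i (s j))
    (hne : ∃ v, v ∉ Set.range s) (i₀ : I) :
    (Finset.univ.filter fun y => y ∉ (Finset.univ.erase i₀).image s ∧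
      IsDominant r (insert y ((Finset.univ.erase i₀).image s))).card = 1 := by
  obtain ⟨v₀, hv₀⟩ := hne
  obtain ⟨y₀, hy₀, hy₀max⟩ := (Finset.univ.filter (· ∉ Set.range s)).exists_max_image (r i₀)
    ⟨v₀, by simpa using hv₀⟩
  simp only [Finset.mem_filter, Finset.mem_univ, true_and] at hy₀ hy₀max
  have hns : ∀ {z}, z ∉ Set.range s → ∀ i, r i (s i) < r i z := fun hz i =>
    hmin i _ fun h => hz ⟨i, h.symm⟩
  have hmem : ∀ i, i ≠ i₀ → s i ∈ (Finset.univ.erase i₀).image s := fun i hi =>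
    Finset.mem_image_of_mem _ (by simpa using hi)
  rw [Finset.card_eq_one]
  refine ⟨y₀, ?_⟩
  ext y
  simp only [Finset.mem_filter, Finset.mem_univ, true_and, Finset.mem_singleton]
  constructor
  · rintro ⟨hy, hdom⟩
    have hle : ∀ z, z ∉ Set.range s → r i₀ z ≤ r i₀ y := by
      intro z hz
      obtain ⟨i, hi⟩ := hdom z
      by_cases h : i = i₀
      · subst h; exact hi _ (Finset.mem_insert_self _ _)
      · exact absurd (hi _ (Finset.mem_insert_of_mem (hmem i h))) (not_le.2 (hns hz i))
    have hys : y ∉ Set.range s := by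
      rintro ⟨i, rfl⟩
      by_cases h : i = i₀
      · subst h; exact absurd (hle v₀ hv₀) (not_le.2 (hns hv₀ i))
      · exact hy (hmem i h)
    exact hr i₀ (le_antisymm (hy₀max y hys) (hle y₀ hy₀))
  · rintro rfl
    refine ⟨fun h => ?_, fun z => ?_⟩
    · obtain ⟨i, -, hi⟩ := Finset.mem_image.1 h
      exact hy₀ ⟨i, hi⟩
    · by_cases hz : z ∈ Set.range s
      · obtain ⟨i, rfl⟩ := hz
        refine ⟨i, fun x _ => ?_⟩
        by_cases hx : x = s i
        · rw [hx]
        · exact (hmin i x hx).le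
      · refine ⟨i₀, fun x hx => ?_⟩
        rcases Finset.mem_insert.1 hx with rfl | hx
        · exact hy₀max z hz
        · obtain ⟨i, hi, rfl⟩ := Finset.mem_image.1 hx
          exact (hmax i₀ i z (by simpa using (Finset.ne_of_mem_erase hi).symm) hz).le

open Classical in
/-- A set with as many elements as there are labels, not carrying all of them, has an even number
of facets carrying exactly the labels other than `i₀`. -/
theorem even_card_facets {V I : Type*} [Fintype V] [Fintype I] (c : V → I) (i₀ : I)
    (S : Finset V) (hS : S.image c ≠ Finset.univ) :
    Even (Finset.univ.filter fun p : Finset V × V => p.2 ∉ p.1 ∧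
      p.1.card + 1 = Fintype.card I ∧ p.1.image c = Finset.univ.erase i₀ ∧
      insert p.2 p.1 = S).card := by
  rcases Finset.eq_empty_or_nonempty (Finset.univ.filter fun p : Finset V × V => p.2 ∉ p.1 ∧
      p.1.card + 1 = Fintype.card I ∧ p.1.image c = Finset.univ.erase i₀ ∧
      insert p.2 p.1 = S) with h | ⟨⟨D, y⟩, h⟩
  · simp [h]
  simp only [Finset.mem_filter, Finset.mem_univ, true_and] at h
  obtain ⟨hyD, hcard, hc, hDS⟩ := h
  have hinj : ∀ {E : Finset V}, E.card + 1 = Fintype.card I → E.image c = Finset.univ.erase i₀ →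
      Set.InjOn c E := by
    intro E hE hcE
    refine Finset.card_image_iff.1 ?_
    rw [hcE, Finset.card_erase_of_mem (Finset.mem_univ _), Finset.card_univ]
    omega
  have hcy : c y ≠ i₀ := by
    rintro rfl
    apply hS
    rw [← hDS, Finset.image_insert, hc, Finset.insert_erase (Finset.mem_univ _)]
  obtain ⟨x, hxD, hxy⟩ : ∃ x ∈ D, c x = c y := by
    have : c y ∈ D.image c := by rw [hc]; simpa using hcy
    simpa using this
  have hne : x ≠ y := fun h => hyD (h ▸ hxD)
  suffices hcard2 : (Finset.univ.filter fun p : Finset V × V => p.2 ∉ p.1 ∧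
      p.1.card + 1 = Fintype.card I ∧ p.1.image c = Finset.univ.erase i₀ ∧
      insert p.2 p.1 = S).card = 2 by rw [hcard2]; exact even_two
  rw [Finset.card_eq_two]
  refine ⟨(D, y), (insert y (D.erase x), x), fun h => hne (congrArg Prod.snd h).symm, ?_⟩
  ext ⟨E, z⟩
  simp only [Finset.mem_filter, Finset.mem_univ, true_and, Finset.mem_insert,
    Finset.mem_singleton, Prod.mk.injEq]
  constructor
  · rintro ⟨hzE, hEcard, hcE, hES⟩
    have hE : E = (insert y D).erase z := by rw [hDS, ← hES, Finset.erase_insert hzE]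
    by_cases hzy : z = y
    · subst hzy
      exact Or.inl ⟨by rw [hE, Finset.erase_insert hyD], rfl⟩
    · have hzD : z ∈ D := by
        have : z ∈ insert y D := by rw [hDS, ← hES]; exact Finset.mem_insert_self _ _
        exact (Finset.mem_insert.1 this).resolve_left hzy
      have hcz : c z ∈ E.image c := by
        rw [hcE, ← hc]; exact Finset.mem_image_of_mem _ hzD
      obtain ⟨w, hwE, hw⟩ := Finset.mem_image.1 hcz
      have hwz : w ≠ z := fun h => hzE (h ▸ hwE)
      have hwy : w = y := by
        have : w ∈ insert y D := by rw [hDS, ← hES]; exact Finset.mem_insert_of_mem hwE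
        refine (Finset.mem_insert.1 this).resolve_right fun hwD => hwz ?_
        exact hinj hcard hc hwD hzD hw
      have hzx : z = x := hinj hcard hc hzD hxD (by rw [hxy, ← hw, hwy])
      subst hzx
      exact Or.inr ⟨by rw [hE, Finset.erase_insert_of_ne hne.symm], rfl⟩
  · rintro (⟨rfl, rfl⟩ | ⟨rfl, rfl⟩)
    · exact ⟨hyD, hcard, hc, hDS⟩
    · have hyE : y ∉ D.erase z := fun h => hyD (Finset.mem_of_mem_erase h)
      refine ⟨by simp [hne], ?_, ?_, ?_⟩
      · rw [Finset.card_insert_of_notMem hyE, Finset.card_erase_of_mem hxD]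
        have := Finset.card_pos.2 ⟨z, hxD⟩
        omega
      · rw [Finset.image_insert, ← hxy, ← Finset.image_insert, Finset.insert_erase hxD, hc]
      · rw [Finset.insert_comm, Finset.insert_erase hxD, hDS]

open Classical in
/-- **Scarf's lemma**, with slack points. -/
theorem exists_isDominant_image_eq_univ {V I L : Type*} [Fintype V] [Fintype I] [Nonempty I]
    [LinearOrder L] {r : I → V → L} (hr : ∀ i, Function.Injective (r i)) {s : I → V}
    (hmin : ∀ i v, v ≠ s i → r i (s i) < r i v)
    (hmax : ∀ i j v, i ≠ j → v ∉ Set.range s → r i v < r i (s j))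
    (hne : ∃ v, v ∉ Set.range s) (c : V → I) (hcs : ∀ i, c (s i) = i) :
    ∃ S : Finset V, IsDominant r S ∧ S.card = Fintype.card I ∧ S.image c = Finset.univ := by
  by_contra hcon
  push Not at hcon
  obtain ⟨i₀⟩ := ‹Nonempty I›
  let F := Finset.univ.filter fun p : Finset V × V => p.2 ∉ p.1 ∧
    p.1.card + 1 = Fintype.card I ∧ p.1.image c = Finset.univ.erase i₀ ∧
    IsDominant r (insert p.2 p.1)
  have heven : Even F.card := by
    rw [Finset.card_eq_sum_card_fiberwise (f := fun p => insert p.2 p.1)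
      (t := Finset.univ) (fun _ _ => Finset.mem_univ _)]
    refine Finset.even_sum _ fun S _ => ?_
    by_cases hS : IsDominant r S ∧ S.card = Fintype.card I
    · refine (congrArg (fun A => Even (Finset.card A)) ?_).mpr
        (even_card_facets c i₀ S (hcon S hS.1 hS.2))
      ext p
      simp only [F, Finset.mem_filter, Finset.mem_univ, true_and]
      constructor
      · rintro ⟨⟨h1, h2, h3, -⟩, h5⟩
        exact ⟨h1, h2, h3, h5⟩
      · rintro ⟨h1, h2, h3, h5⟩
        exact ⟨⟨h1, h2, h3, h5 ▸ hS.1⟩, h5⟩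
    · suffices h : (F.filter fun p => insert p.2 p.1 = S) = ∅ by simp [h]
      rw [Finset.filter_eq_empty_iff]
      rintro p hp rfl
      simp only [F, Finset.mem_filter, Finset.mem_univ, true_and] at hp
      exact hS ⟨hp.2.2.2, by rw [Finset.card_insert_of_notMem hp.1, hp.2.1]⟩
  have hfib : ∀ D : Finset V, D.card + 1 = Fintype.card I → D.image c = Finset.univ.erase i₀ →
      (F.filter fun p => p.1 = D).card =
        (Finset.univ.filter fun y => y ∉ D ∧ IsDominant r (insert y D)).card := by
    intro D hD hc
    refine Finset.card_bij' (fun p _ => p.2) (fun y _ => (D, y)) ?_ ?_ ?_ ?_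
    · rintro ⟨E, y⟩ h
      simp only [F, Finset.mem_filter, Finset.mem_univ, true_and] at h ⊢
      obtain ⟨⟨h1, -, -, h2⟩, rfl⟩ := h
      exact ⟨h1, h2⟩
    · intro y h
      simp only [F, Finset.mem_filter, Finset.mem_univ, true_and] at h ⊢
      exact ⟨⟨h.1, hD, hc, h.2⟩, trivial⟩
    · rintro ⟨E, y⟩ h
      simp only [Finset.mem_filter] at h
      rw [← h.2]
    · intro y _
      rfl
  have hsinj : Function.Injective s := Function.LeftInverse.injective hcs
  let D₀ := (Finset.univ.erase i₀).image s
  have hD₀card : D₀.card + 1 = Fintype.card I := by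
    rw [Finset.card_image_of_injective _ hsinj, Finset.card_erase_of_mem (Finset.mem_univ _),
      Finset.card_univ]
    have : 0 < Fintype.card I := Fintype.card_pos_iff.2 ⟨i₀⟩
    omega
  have hD₀c : D₀.image c = Finset.univ.erase i₀ := by
    rw [Finset.image_image, show c ∘ s = id from funext hcs, Finset.image_id]
  have hodd : Odd F.card := by
    rw [Finset.card_eq_sum_card_fiberwise (f := Prod.fst)
      (t := Finset.univ) (fun _ _ => Finset.mem_univ _),
      ← Finset.add_sum_erase _ _ (Finset.mem_univ D₀), hfib D₀ hD₀card hD₀c,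
      card_extensions_slack hr hmin hmax hne i₀, add_comm]
    refine Even.add_one (Finset.even_sum _ fun D hD => ?_)
    rcases Finset.eq_empty_or_nonempty (F.filter fun p => p.1 = D) with h | ⟨⟨E, y⟩, h⟩
    · simp [h]
    simp only [F, Finset.mem_filter, Finset.mem_univ, true_and] at h
    obtain ⟨⟨-, hcard, hc, hdom⟩, rfl⟩ := h
    rw [hfib E hcard hc, IsDominant.card_extensions hr hmin hmax
      (hdom.mono (Finset.subset_insert _ _)) hcard]
    · exact even_two
    · by_contra hall
      push Not at hall
      refine Finset.ne_of_mem_erase hD (Finset.eq_of_subset_of_card_le ?_ (by omega))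
      intro x hx
      obtain ⟨i, rfl⟩ := hall x hx
      refine Finset.mem_image_of_mem _ ?_
      rw [← hc]
      exact Finset.mem_image.2 ⟨_, hx, hcs i⟩
  exact (Nat.not_even_iff_odd.2 hodd) heven

open Classical in
/-- Scarf's lemma for the grid points of the standard simplex with denominator `N`. -/
theorem exists_grid_point {I : Type*} [Fintype I] [Nonempty I] (N : ℕ) (c : (I → ℕ) → I) :
    ∃ z : I → ℕ, ∑ i, z i = N ∧ ∀ i, z i < Fintype.card I ∨
      ∃ w : I → ℕ, ∑ l, w l = N ∧ c w = i ∧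
        ∀ l, z l < w l + Fintype.card I ∧ w l < z l + Fintype.card I := by
  let T := {x : I → ℕ // x ∈ Finset.piAntidiag Finset.univ N}
  have : Fintype T := FinsetCoe.fintype _
  have hT : ∀ x : I → ℕ, x ∈ Finset.piAntidiag Finset.univ N ↔ ∑ i, x i = N := by
    intro x; simp [Finset.mem_piAntidiag]
  let e := Fintype.equivFin (T ⊕ I)
  let b : I → T ⊕ I → ℕ := fun i => Sum.elim (fun x => x.1 i + 1)
    (fun j => if i = j then 0 else N + 2)
  let r : I → T ⊕ I → ℕ ×ₗ Fin (Fintype.card (T ⊕ I)) := fun i v => toLex (b i v, e v)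
  have hlt : ∀ {i u v}, b i u < b i v → r i u < r i v := fun h =>
    Prod.Lex.toLex_lt_toLex.2 (Or.inl h)
  have hle : ∀ {i u v}, r i u ≤ r i v → b i u ≤ b i v := fun h =>
    not_lt.1 fun h' => absurd h (not_le.2 (hlt h'))
  have hr : ∀ i, Function.Injective (r i) := fun i u v h =>
    e.injective (congrArg Prod.snd (toLex.injective h))
  have hmin : ∀ i v, v ≠ Sum.inr i → r i (Sum.inr i) < r i v := by
    rintro i (x | j) hv <;> apply hlt
    · simp [b]
    · have : i ≠ j := fun h => hv (by rw [h])
      simp [b, this]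
  have hmax : ∀ i j v, i ≠ j → v ∉ Set.range (Sum.inr : I → T ⊕ I) →
      r i v < r i (Sum.inr j) := by
    rintro i j (x | k) hij hv
    · apply hlt
      have h1 := Finset.single_le_sum (f := x.1) (fun _ _ => Nat.zero_le _) (Finset.mem_univ i)
      rw [(hT x.1).1 x.2] at h1
      simp only [b, Sum.elim_inl, Sum.elim_inr, hij, if_false]
      omega
    · exact absurd ⟨k, rfl⟩ hv
  obtain ⟨i₀⟩ := ‹Nonempty I›
  let x₀ : T := ⟨Pi.single i₀ N, (hT _).2 (by simp)⟩
  have : Nonempty I := ⟨i₀⟩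
  obtain ⟨S, hdom, -, hSc⟩ := exists_isDominant_image_eq_univ hr hmin hmax ⟨Sum.inl x₀, by simp⟩
    (Sum.elim (fun x => c x.1) id) (fun _ => rfl)
  have hlabel : ∀ i, Sum.inr i ∈ S ∨ ∃ w : T, Sum.inl w ∈ S ∧ c w.1 = i := by
    intro i
    have hi := Finset.mem_univ i
    rw [← hSc] at hi
    obtain ⟨x | j, hx, rfl⟩ := Finset.mem_image.1 hi
    · exact Or.inr ⟨x, hx, rfl⟩
    · exact Or.inl hx
  have hdom' : ∀ y : T, ∃ i, Sum.inr i ∉ S ∧ ∀ w : T, Sum.inl w ∈ S → y.1 i ≤ w.1 i := by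
    intro y
    obtain ⟨i, hi⟩ := hdom (Sum.inl y)
    refine ⟨i, fun h => ?_, fun w hw => ?_⟩
    · have := hle (hi _ h)
      simp [b] at this
    · have := hle (hi _ hw)
      simpa [b] using this
  have hclose : ∀ z : T, Sum.inl z ∈ S → ∀ i, z.1 i < Fintype.card I ∨
      (Sum.inr i ∉ S ∧ ∀ w : T, Sum.inl w ∈ S → z.1 i < w.1 i + Fintype.card I) := by
    intro z hz i
    by_contra! hcon
    obtain ⟨hzi, hcon⟩ := hcon
    let C := Finset.univ.filter fun l => (Sum.inr l : T ⊕ I) ∉ S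
    have hCcard : C.card ≤ Fintype.card I := Finset.card_le_univ C
    let y : I → ℕ := fun l => if l = i then z.1 i + (if i ∈ C then 1 else 0) - C.card
      else z.1 l + (if l ∈ C then 1 else 0)
    have hysum : ∑ l, y l = N := by
      have h1 : ∑ l, (z.1 l + (if l ∈ C then 1 else 0)) = N + C.card := by
        rw [Finset.sum_add_distrib, (hT _).1 z.2]
        simp
      rw [← Finset.add_sum_erase _ _ (Finset.mem_univ i)] at h1 ⊢
      have h2 : ∑ l ∈ Finset.univ.erase i, y l =
          ∑ l ∈ Finset.univ.erase i, (z.1 l + (if l ∈ C then 1 else 0)) :=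
        Finset.sum_congr rfl fun l hl => by simp [y, Finset.ne_of_mem_erase hl]
      rw [h2]
      simp only [y, if_true]
      omega
    obtain ⟨l, hlS, hl⟩ := hdom' ⟨y, (hT _).2 hysum⟩
    have hlC : l ∈ C := by simpa [C] using hlS
    by_cases hli : l = i
    · subst hli
      obtain ⟨w, hw, hwz⟩ := hcon hlS
      have := hl w hw
      simp only [y, if_true, hlC] at this
      omega
    · have := hl z hz
      simp only [y, hli, if_false, hlC, if_true] at this
      omega
  obtain ⟨z, hz⟩ : ∃ z : T, Sum.inl z ∈ S := by
    obtain ⟨i, hi, -⟩ := hdom' x₀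
    obtain ⟨w, hw, -⟩ := (hlabel i).resolve_left hi
    exact ⟨w, hw⟩
  have hlt' : ∀ z w : T, Sum.inl z ∈ S → Sum.inl w ∈ S → ∀ l,
      z.1 l < w.1 l + Fintype.card I := by
    intro z w hz hw l
    rcases hclose z hz l with h | h
    · omega
    · exact h.2 w hw
  refine ⟨z.1, (hT _).1 z.2, fun i => ?_⟩
  rcases hlabel i with hi | ⟨w, hw, hwi⟩
  · exact Or.inl ((hclose z hz i).resolve_right fun h => h.1 hi)
  · exact Or.inr ⟨w.1, (hT _).1 w.2, hwi, fun l => ⟨hlt' z w hz hw l, hlt' w z hw hz l⟩⟩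

open Filter Topology in
/-- **Brouwer's fixed point theorem** for the standard simplex. -/
theorem exists_isFixedPt_stdSimplex {I : Type*} [Fintype I] [Nonempty I]
    {f : (I → ℝ) → I → ℝ} (hf : ContinuousOn f (stdSimplex ℝ I))
    (hmaps : Set.MapsTo f (stdSimplex ℝ I) (stdSimplex ℝ I)) :
    ∃ x ∈ stdSimplex ℝ I, f x = x := by
  have happrox : ∀ N : ℕ, ∃ z ∈ stdSimplex ℝ I, ∀ i, ∃ w ∈ stdSimplex ℝ I,
      w i - Fintype.card I * (1 / ((N : ℝ) + 1)) ≤ f w i ∧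
      ∀ l, |z l - w l| ≤ Fintype.card I * (1 / ((N : ℝ) + 1)) := by
    intro N
    have hN : (0 : ℝ) < (N : ℝ) + 1 := by positivity
    let p : (I → ℕ) → I → ℝ := fun x i => x i / ((N : ℝ) + 1)
    have hp : ∀ x : I → ℕ, ∑ i, x i = N + 1 → p x ∈ stdSimplex ℝ I := by
      refine fun x hx => ⟨fun i => by positivity, ?_⟩
      simp only [p, ← Finset.sum_div]
      rw [div_eq_one_iff_eq hN.ne']
      exact_mod_cast hx
    have hlabel : ∀ x : I → ℕ, ∃ i, ∑ i, x i = N + 1 → p x i ≤ f (p x) i := by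
      intro x
      by_cases hx : ∑ i, x i = N + 1
      · obtain ⟨i, -, hi⟩ := Finset.exists_le_of_sum_le (s := Finset.univ) (f := p x)
          (g := f (p x)) Finset.univ_nonempty
          (by rw [(hp x hx).2, (hmaps (hp x hx)).2])
        exact ⟨i, fun _ => hi⟩
      · exact ⟨Classical.arbitrary I, fun h => absurd h hx⟩
    choose c hc using hlabel
    obtain ⟨z, hz, hzi⟩ := exists_grid_point (N + 1) c
    refine ⟨p z, hp z hz, fun i => ?_⟩
    rcases hzi i with h | ⟨w, hw, rfl, hzw⟩
    · refine ⟨p z, hp z hz, ?_, fun l => ?_⟩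
      · have h1 : (0 : ℝ) ≤ f (p z) i := (hmaps (hp z hz)).1 i
        have h2 : (z i : ℝ) ≤ Fintype.card I := by exact_mod_cast h.le
        have h3 : p z i ≤ Fintype.card I * (1 / ((N : ℝ) + 1)) := by
          rw [mul_one_div]; exact div_le_div_of_nonneg_right h2 hN.le
        linarith
      · rw [sub_self, abs_zero]; positivity
    · have hpos : (0 : ℝ) ≤ Fintype.card I * (1 / ((N : ℝ) + 1)) := by positivity
      refine ⟨p w, hp w hw, by linarith [hc w hw], fun l => ?_⟩
      have h1 : (z l : ℝ) ≤ w l + Fintype.card I := by exact_mod_cast (hzw l).1.le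
      have h2 : (w l : ℝ) ≤ z l + Fintype.card I := by exact_mod_cast (hzw l).2.le
      rw [← sub_div, abs_div, abs_of_pos hN, mul_one_div]
      refine div_le_div_of_nonneg_right (abs_le.2 ⟨?_, ?_⟩) hN.le <;> linarith
  choose z hz w hw hwf hzw using happrox
  obtain ⟨x, hx, φ, hφ, hlim⟩ := (isCompact_stdSimplex ℝ I).tendsto_subseq hz
  have hε : Tendsto (fun k => (Fintype.card I : ℝ) * (1 / ((φ k : ℝ) + 1))) atTop (𝓝 0) := by
    simpa using ((tendsto_one_div_add_atTop_nhds_zero_nat (𝕜 := ℝ)).comp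
      hφ.tendsto_atTop).const_mul (Fintype.card I : ℝ)
  have hge : ∀ i, x i ≤ f x i := by
    intro i
    have hwlim : Tendsto (fun k => w (φ k) i) atTop (𝓝 x) := by
      rw [tendsto_pi_nhds] at hlim ⊢
      intro l
      have h0 : Tendsto (fun k => z (φ k) l - w (φ k) i l) atTop (𝓝 0) :=
        squeeze_zero_norm (fun k => hzw (φ k) i l) hε
      simpa using (hlim l).sub h0
    have hflim : Tendsto (fun k => f (w (φ k) i)) atTop (𝓝 (f x)) :=
      (hf x hx).tendsto.comp (tendsto_nhdsWithin_iff.2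
        ⟨hwlim, Eventually.of_forall fun k => hw (φ k) i⟩)
    have h1 := ((tendsto_pi_nhds.1 hwlim) i).sub hε
    rw [sub_zero] at h1
    exact le_of_tendsto_of_tendsto' h1 ((tendsto_pi_nhds.1 hflim) i) fun k => hwf (φ k) i
  refine ⟨x, hx, funext fun i => ?_⟩
  have hsum : ∑ i, x i = ∑ i, f x i := by rw [hx.2, (hmaps hx).2]
  exact (((Finset.sum_eq_sum_iff_of_le fun i _ => hge i).1 hsum) i (Finset.mem_univ i)).symm

/-- **Browder's fixed point theorem**: a correspondence on a compact convex set with nonempty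
convex values and open fibres has a fixed point. -/
theorem exists_mem_of_isOpen_fibers {E : Type*} [AddCommGroup E] [Module ℝ E]
    [TopologicalSpace E] [ContinuousAdd E] [ContinuousSMul ℝ E] [NormalSpace E] [T2Space E]
    {K : Set E} (hK : IsCompact K) (hKconv : Convex ℝ K) (hKne : K.Nonempty)
    {S : E → Set E} (hconv : ∀ x, Convex ℝ (S x)) (hne : ∀ x ∈ K, (S x ∩ K).Nonempty)
    (hopen : ∀ y, IsOpen {x | y ∈ S x}) : ∃ x ∈ K, x ∈ S x := by
  obtain ⟨t, ht⟩ := hK.elim_finite_subcover (fun y : K => {x | (y : E) ∈ S x})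
    (fun y => hopen y) fun x hx => by
      obtain ⟨y, hyS, hyK⟩ := hne x hx
      exact Set.mem_iUnion.2 ⟨⟨y, hyK⟩, hyS⟩
  obtain ⟨φ, hφ⟩ := PartitionOfUnity.exists_isSubordinate_of_locallyFinite hK.isClosed
    (fun y : t => {x | (y.1 : E) ∈ S x}) (fun y => hopen _) (locallyFinite_of_finite _)
    (fun x hx => by
      obtain ⟨y, hy, hxy⟩ := Set.mem_iUnion₂.1 (ht hx)
      exact Set.mem_iUnion.2 ⟨⟨y, hy⟩, hxy⟩)
  have hφsum : ∀ x ∈ K, ∑ y, φ y x = 1 := fun x hx => by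
    rw [← finsum_eq_sum_of_fintype]; exact φ.sum_eq_one hx
  have : Nonempty t := by
    obtain ⟨x, hx⟩ := hKne
    obtain ⟨y, hy, -⟩ := Set.mem_iUnion₂.1 (ht hx)
    exact ⟨⟨y, hy⟩⟩
  let q : (t → ℝ) → E := fun u => ∑ y, u y • (y.1 : E)
  have hq : Continuous q := by fun_prop
  have hqK : ∀ u ∈ stdSimplex ℝ t, q u ∈ K := fun u hu =>
    hKconv.sum_mem (fun y _ => hu.1 y) hu.2 fun y _ => y.1.2
  obtain ⟨u, hu, hfix⟩ := exists_isFixedPt_stdSimplex (f := fun u y => φ y (q u))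
    (Continuous.continuousOn (by fun_prop))
    fun u hu => ⟨fun y => φ.nonneg y _, hφsum _ (hqK u hu)⟩
  refine ⟨q u, hqK u hu, ?_⟩
  have hsupp : q u = ∑ y with u y ≠ 0, u y • (y.1 : E) := by
    refine (Finset.sum_filter_of_ne (p := fun y => u y ≠ 0) fun y _ h hy => h ?_).symm
    rw [hy, zero_smul]
  have hmem : ∑ y with u y ≠ 0, u y • (y.1 : E) ∈ S (q u) := by
    refine (hconv _).sum_mem (fun y _ => hu.1 y) ?_ fun y hy => ?_
    · rw [Finset.sum_filter_ne_zero]; exact hu.2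
    · refine hφ y (subset_tsupport _ ?_)
      have : u y ≠ 0 := (Finset.mem_filter.1 hy).2
      rwa [← congrFun hfix y] at this
  rwa [← hsupp] at hmem

/-- Under the hypotheses of the Debreu–Glicksberg–Fan theorem, `ε`-equilibria exist. -/
theorem exists_approx_nash {N : Type*} [Fintype N] [DecidableEq N] {n : N → ℕ}
    (K : ∀ ν : N, Set (EuclideanSpace ℝ (Fin (n ν))))
    (hKcomp : ∀ ν, IsCompact (K ν)) (hKconv : ∀ ν, Convex ℝ (K ν))
    (hKne : ∀ ν, (K ν).Nonempty)
    (θ : ∀ _ : N, (∀ ν : N, EuclideanSpace ℝ (Fin (n ν))) → ℝ)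
    (hcont : ∀ ν, Continuous (θ ν))
    (hqc : ∀ (ν : N) (x : ∀ ν : N, EuclideanSpace ℝ (Fin (n ν))),
      ∀ y z : EuclideanSpace ℝ (Fin (n ν)), ∀ t ∈ Set.Icc (0:ℝ) 1,
        θ ν (Function.update x ν (t • y + (1 - t) • z)) ≤
          max (θ ν (Function.update x ν y)) (θ ν (Function.update x ν z)))
    {ε : ℝ} (hε : 0 < ε) :
    ∃ x ∈ Set.univ.pi K, ∀ ν, ∀ z ∈ K ν, θ ν x < θ ν (Function.update x ν z) + ε := by
  have hc : ∀ ν, Continuous fun p : (∀ ν : N, EuclideanSpace ℝ (Fin (n ν))) ×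
      EuclideanSpace ℝ (Fin (n ν)) => θ ν (Function.update p.1 ν p.2) := fun ν =>
    (hcont ν).comp (continuous_fst.update ν continuous_snd)
  suffices h : ∃ x ∈ Set.univ.pi K, ∀ ν, ∀ z ∈ K ν,
      θ ν (Function.update x ν (x ν)) < θ ν (Function.update x ν z) + ε by
    simpa using h
  refine exists_mem_of_isOpen_fibers (isCompact_univ_pi hKcomp)
    (convex_pi fun ν _ => hKconv ν) (Set.univ_pi_nonempty_iff.2 hKne)
    (S := fun x => {y | ∀ ν, ∀ z ∈ K ν,
      θ ν (Function.update x ν (y ν)) < θ ν (Function.update x ν z) + ε}) ?_ ?_ ?_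
  · intro x y hy y' hy' a b ha hb hab ν z hz
    have h := hqc ν x (y ν) (y' ν) a ⟨ha, by linarith⟩
    rw [show 1 - a = b by linarith] at h
    exact h.trans_lt (max_lt (hy ν z hz) (hy' ν z hz))
  · intro x _
    have hex : ∀ ν, ∃ y ∈ K ν, ∀ z ∈ K ν,
        θ ν (Function.update x ν y) ≤ θ ν (Function.update x ν z) := fun ν =>
      (hKcomp ν).exists_isMinOn (hKne ν)
        ((hc ν).comp (Continuous.prodMk_right x)).continuousOn
    choose y hyK hy using hex
    exact ⟨y, fun ν z hz => by linarith [hy ν z hz], fun ν _ => hyK ν⟩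
  · intro y
    rw [isOpen_iff_eventually]
    intro x hx
    refine Filter.eventually_all.2 fun ν => ?_
    exact (hKcomp ν).eventually_forall_of_forall_eventually (x₀ := x)
      (P := fun x z => θ ν (Function.update x ν (y ν)) < θ ν (Function.update x ν z) + ε)
      fun z hz => ((hc ν).comp (continuous_fst.prodMk continuous_const)).continuousAt.eventually_lt
        ((hc ν).add continuous_const).continuousAt (hx ν z hz)

/-- **(Debreu–Glicksberg–Fan)** If each strategy set `K ν ⊆ ℝ^{n_ν}` is compact, convex and
nonempty, and each objective function `θ ν` is continuous and quasi-convex with respect to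
its player's variable, then the game admits a Nash equilibrium. -/
theorem debreu_glicksberg_fan_existence
    {N : Type*} [Fintype N] [Nonempty N] [DecidableEq N] {n : N → ℕ}
    (K : ∀ ν : N, Set (EuclideanSpace ℝ (Fin (n ν))))
    (hKcomp : ∀ ν, IsCompact (K ν)) (hKconv : ∀ ν, Convex ℝ (K ν))
    (hKne : ∀ ν, (K ν).Nonempty)
    (θ : ∀ _ : N, (∀ ν : N, EuclideanSpace ℝ (Fin (n ν))) → ℝ)
    (hcont : ∀ ν, Continuous (θ ν))
    (hqc : ∀ (ν : N) (x : ∀ ν : N, EuclideanSpace ℝ (Fin (n ν))),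
      ∀ y z : EuclideanSpace ℝ (Fin (n ν)), ∀ t ∈ Set.Icc (0:ℝ) 1,
        θ ν (Function.update x ν (t • y + (1 - t) • z)) ≤
          max (θ ν (Function.update x ν y)) (θ ν (Function.update x ν z))) :
    ∃ xhat : ∀ ν : N, EuclideanSpace ℝ (Fin (n ν)),
      (∀ ν, xhat ν ∈ K ν) ∧
      ∀ ν : N, ∀ y ∈ K ν, θ ν xhat ≤ θ ν (Function.update xhat ν y) := by
  have happrox := fun k : ℕ => exists_approx_nash K hKcomp hKconv hKne θ hcont hqc
    (Nat.one_div_pos_of_nat (α := ℝ) (n := k))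
  choose x hxK hx using happrox
  obtain ⟨xhat, hxhat, φ, hφ, hlim⟩ := (isCompact_univ_pi hKcomp).tendsto_subseq hxK
  refine ⟨xhat, fun ν => hxhat ν trivial, fun ν y hy => ?_⟩
  have hleft := ((hcont ν).tendsto xhat).comp hlim
  have hright := (((hcont ν).comp (continuous_id.update ν (continuous_const (y := y)))).tendsto xhat).comp
    hlim |>.add ((tendsto_one_div_add_atTop_nhds_zero_nat (𝕜 := ℝ)).comp hφ.tendsto_atTop)
  rw [add_zero] at hright
  exact le_of_tendsto_of_tendsto' hleft hright fun k => (hx (φ k) ν y hy).le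
end
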